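/- arXiv:2510.20231 — 4 statements merged into one kernel-verified Lean document; each statement's English description precedes it below -/
import Mathlib

section
/- Let M be a p×q real matrix, W₀ a q×n² real matrix, and W an n×n real symmetric positive-semidefinite matrix such that the matrix (W ⊗ W) − W₀ᵀ Mᵀ M W₀ is positive semidefinite. Then for every m ∈ ℝⁿ, ‖M W₀ (m ⊗ m)‖ ≤ mᵀ W m. -/
open Kronecker Matrix

/-- Let `M` be `p×q`, `W₀` be `q×n²`, and `W` be an `n×n` symmetric
positive-semidefinite matrix such that `(W ⊗ W) − W₀ᵀ Mᵀ M W₀` is positive semidefinite.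
Then for every `m ∈ ℝⁿ`, `‖M W₀ (m ⊗ m)‖ ≤ mᵀ W m` (Euclidean norm). -/
theorem stmt_3 (n p q : ℕ) (M : Matrix (Fin p) (Fin q) ℝ)
    (W₀ : Matrix (Fin q) (Fin n × Fin n) ℝ) (W : Matrix (Fin n) (Fin n) ℝ)
    (hW : W.PosSemidef)
    (hle : ((W ⊗ₖ W) - (W₀ᵀ * Mᵀ * M * W₀)).PosSemidef) :
    ∀ m : Fin n → ℝ,
      Real.sqrt ((M.mulVec (W₀.mulVec (fun pr : Fin n × Fin n => m pr.1 * m pr.2))) ⬝ᵥ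
          (M.mulVec (W₀.mulVec (fun pr : Fin n × Fin n => m pr.1 * m pr.2))))
        ≤ m ⬝ᵥ W.mulVec m := by
  intro m
  have h1 : 0 ≤ m ⬝ᵥ W.mulVec m := by simpa using hW.dotProduct_mulVec_nonneg m
  refine Real.sqrt_le_iff.mpr ⟨h1, ?_⟩
  set v : Fin n × Fin n → ℝ := fun pr => m pr.1 * m pr.2 with hv
  have h2 : 0 ≤ v ⬝ᵥ ((W ⊗ₖ W) - (W₀ᵀ * Mᵀ * M * W₀)).mulVec v := by
    simpa using hle.dotProduct_mulVec_nonneg v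
  have h3 : v ⬝ᵥ (W₀ᵀ * Mᵀ * M * W₀).mulVec v =
      (M.mulVec (W₀.mulVec v)) ⬝ᵥ (M.mulVec (W₀.mulVec v)) := by
    simp only [← Matrix.mulVec_mulVec]
    rw [Matrix.dotProduct_mulVec v, Matrix.vecMul_transpose, Matrix.dotProduct_mulVec _ Mᵀ,
      Matrix.vecMul_transpose]
  have h5 : (W ⊗ₖ W).mulVec v = fun pr => W.mulVec m pr.1 * W.mulVec m pr.2 := by
    funext pr
    simp only [Matrix.mulVec, dotProduct, Finset.sum_mul_sum, Fintype.sum_prod_type, hv,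
      Matrix.kroneckerMap_apply]
    refine Finset.sum_congr rfl fun i _ => Finset.sum_congr rfl fun j _ => ?_
    ring
  have h4 : v ⬝ᵥ (W ⊗ₖ W).mulVec v = (m ⬝ᵥ W.mulVec m) ^ 2 := by
    rw [h5, sq]
    simp only [dotProduct, Finset.sum_mul_sum, Fintype.sum_prod_type, hv]
    refine Finset.sum_congr rfl fun i _ => Finset.sum_congr rfl fun j _ => ?_
    ring
  rw [Matrix.sub_mulVec, dotProduct_sub, h3, h4] at h2
  linarith
end

section
/- Let φ : ℝ → ℝ be Lipschitz with constant K ≥ 0, extended coordinatewise, let W₁, …, W_{L+1} be nonzero real matrices and b₁, …, b_{L+1} vectors, and let ΔW₁, …, ΔW_{L+1} be perturbation matrices of the same sizes. Define the perturbed network F_Δ(x) = (W_{L+1}+ΔW_{L+1}) φ( ⋯ φ((W₁+ΔW₁) x + b₁) ⋯ ) + b_{L+1}. Then F_Δ is Lipschitz with constant at most K^L · ∏_{l=1}^{L+1} σ(W_l) · ∏_{l=1}^{L+1} (1 + ‖ΔW_l‖_F / σ(W_l)), where σ(·) is the spectral norm and ‖·‖_F the Frobenius norm. -/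
open Finset

/-- Coordinatewise action of a scalar function on a Euclidean vector. -/
noncomputable def coordAct {m : ℕ} (φ : ℝ → ℝ) (v : EuclideanSpace ℝ (Fin m)) :
    EuclideanSpace ℝ (Fin m) :=
  (WithLp.equiv 2 (Fin m → ℝ)).symm fun i => φ ((WithLp.equiv 2 (Fin m → ℝ)) v i)

/-- Multi-layer perceptron with layer widths `d`, weights `W`, biases `b`, activation `φ`:
`mlp L x = W_{L} φ(⋯ φ(W₀ x + b₀) ⋯) + b_{L}` (that is, `L+1` affine layers and `L` hidden
activation layers, indexed here from `0`). -/
noncomputable def mlp (φ : ℝ → ℝ) (d : ℕ → ℕ)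
    (W : ∀ l, Matrix (Fin (d (l + 1))) (Fin (d l)) ℝ)
    (b : ∀ l, EuclideanSpace ℝ (Fin (d (l + 1)))) :
    (L : ℕ) → EuclideanSpace ℝ (Fin (d 0)) → EuclideanSpace ℝ (Fin (d (L + 1)))
  | 0, x => Matrix.toEuclideanLin (W 0) x + b 0
  | (L + 1), x => Matrix.toEuclideanLin (W (L + 1)) (coordAct φ (mlp φ d W b L x)) + b (L + 1)

/-- Spectral norm (largest singular value, i.e. the `ℓ²→ℓ²` operator norm) of a matrix. -/
noncomputable def specNorm {m n : ℕ} (A : Matrix (Fin m) (Fin n) ℝ) : ℝ :=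
  ‖(Matrix.toEuclideanLin A).toContinuousLinearMap‖

/-- Frobenius norm of a matrix. -/
noncomputable def frobNorm {m n : ℕ} (A : Matrix (Fin m) (Fin n) ℝ) : ℝ :=
  Real.sqrt (∑ i, ∑ j, (A i j) ^ 2)

theorem aux_coord {m : ℕ} (φ : ℝ → ℝ) (K : ℝ) (hK : 0 ≤ K)
    (hφ : ∀ s t : ℝ, |φ s - φ t| ≤ K * |s - t|) (u v : EuclideanSpace ℝ (Fin m)) :
    ‖coordAct φ u - coordAct φ v‖ ≤ K * ‖u - v‖ := by
  rw [EuclideanSpace.norm_eq, EuclideanSpace.norm_eq]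
  apply Real.sqrt_le_iff.2
  refine ⟨by positivity, ?_⟩
  rw [mul_pow, Real.sq_sqrt (by positivity), Finset.mul_sum]
  refine Finset.sum_le_sum fun i _ => ?_
  rw [← mul_pow]
  exact pow_le_pow_left₀ (norm_nonneg _) (hφ (u i) (v i)) 2

theorem aux_frob {m n : ℕ} (A : Matrix (Fin m) (Fin n) ℝ) : specNorm A ≤ frobNorm A := by
  refine ContinuousLinearMap.opNorm_le_bound _ (Real.sqrt_nonneg _) fun x => ?_
  rw [EuclideanSpace.norm_eq, EuclideanSpace.norm_eq, frobNorm,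
    ← Real.sqrt_mul (by positivity)]
  apply Real.sqrt_le_sqrt
  rw [Finset.sum_mul]
  refine Finset.sum_le_sum fun i _ => ?_
  have := Finset.sum_mul_sq_le_sq_mul_sq Finset.univ (fun j => A i j) (fun j => x j)
  simpa [Matrix.toLpLin_apply, Matrix.mulVec, dotProduct] using this

theorem aux_layer {m n : ℕ} (W D : Matrix (Fin m) (Fin n) ℝ) (hW : W ≠ 0)
    (b : EuclideanSpace ℝ (Fin m)) (x y : EuclideanSpace ℝ (Fin n)) :
    ‖(Matrix.toEuclideanLin (W + D) x + b) - (Matrix.toEuclideanLin (W + D) y + b)‖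
      ≤ (specNorm W * (1 + frobNorm D / specNorm W)) * ‖x - y‖ := by
  have hpos : specNorm W ≠ 0 := by
    intro h
    apply hW
    have h1 := norm_eq_zero.1 h
    simpa using h1
  have e : specNorm W * (1 + frobNorm D / specNorm W) = specNorm W + frobNorm D := by
    field_simp
  rw [e, add_sub_add_right_eq_sub, ← map_sub, map_add, LinearMap.add_apply, add_mul]
  refine (norm_add_le _ _).trans (add_le_add ?_ ?_)
  · exact (Matrix.toEuclideanLin W).toContinuousLinearMap.le_opNorm (x - y)
  · refine ((Matrix.toEuclideanLin D).toContinuousLinearMap.le_opNorm (x - y)).trans ?_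
    exact mul_le_mul_of_nonneg_right (aux_frob D) (norm_nonneg _)

/-- If the activation `φ` is Lipschitz with constant `K ≥ 0` and the weight
matrices `W_l` are nonzero, then the perturbed network
`F_Δ(x) = (W_{L+1}+ΔW_{L+1}) φ(⋯ φ((W₁+ΔW₁) x + b₁) ⋯) + b_{L+1}` is Lipschitz with
constant at most `K^L · ∏_{l=1}^{L+1} σ(W_l) · ∏_{l=1}^{L+1} (1 + ‖ΔW_l‖_F / σ(W_l))`. -/
theorem stmt_13 (φ : ℝ → ℝ) (K : ℝ) (hK : 0 ≤ K)
    (hφ : ∀ s t : ℝ, |φ s - φ t| ≤ K * |s - t|)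
    (d : ℕ → ℕ) (W ΔW : ∀ l, Matrix (Fin (d (l + 1))) (Fin (d l)) ℝ)
    (b : ∀ l, EuclideanSpace ℝ (Fin (d (l + 1)))) (L : ℕ)
    (hW : ∀ l ≤ L, W l ≠ 0) :
    ∀ x y : EuclideanSpace ℝ (Fin (d 0)),
      ‖mlp φ d (fun l => W l + ΔW l) b L x - mlp φ d (fun l => W l + ΔW l) b L y‖
        ≤ (K ^ L * (∏ l ∈ Finset.range (L + 1), specNorm (W l)) *
            ∏ l ∈ Finset.range (L + 1), (1 + frobNorm (ΔW l) / specNorm (W l))) *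
          ‖x - y‖ := by
  induction L with
  | zero =>
    intro x y
    simpa [mlp] using aux_layer (W 0) (ΔW 0) (hW 0 le_rfl) (b 0) x y
  | succ L ih =>
    intro x y
    have h1 := ih (fun l hl => hW l (by omega)) x y
    have h2 := aux_layer (W (L + 1)) (ΔW (L + 1)) (hW _ le_rfl) (b (L + 1))
      (coordAct φ (mlp φ d (fun l => W l + ΔW l) b L x))
      (coordAct φ (mlp φ d (fun l => W l + ΔW l) b L y))
    have h3 := (aux_coord φ K hK hφ (mlp φ d (fun l => W l + ΔW l) b L x)
      (mlp φ d (fun l => W l + ΔW l) b L y)).trans (mul_le_mul_of_nonneg_left h1 hK)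
    have h4 : 0 ≤ specNorm (W (L + 1)) * (1 + frobNorm (ΔW (L + 1)) / specNorm (W (L + 1))) := by
      have a : 0 ≤ specNorm (W (L + 1)) := norm_nonneg _
      have c : 0 ≤ frobNorm (ΔW (L + 1)) := Real.sqrt_nonneg _
      positivity
    refine (h2.trans (mul_le_mul_of_nonneg_left h3 h4)).trans (le_of_eq ?_)
    rw [Finset.prod_range_succ _ (L + 1), Finset.prod_range_succ _ (L + 1)]
    ring
end

section
/- Let L be an n×n real matrix, and let β, k_A, γ, ε₂, k₁ be real constants. Define A₁₁ = −(k_A/2)·L, A₂₂ = γ·A₁₁, A₂₁ = (ε₂/2)·(Iₙ − (γ k₁/2)·L), and the block matrices A_orb = [[A₁₁, 0], [A₂₁, A₂₂]] and A_gnd = [[−D, −P], [Iₙ, 0]], where D = β·(k_A(1+γ)/2)·L and P = (β² k_A² γ/4)·L². Let Θ₁₁ be any n×n matrix commuting with L, and define Θ₁₂ = (β k_A γ/2)·L·Θ₁₁, Θ₂₂ = (β ε₂/2)·(Iₙ − (γ k₁/2)·L)·Θ₁₁, and Θ = [[Θ₁₁, Θ₁₂], [0, Θ₂₂]]. Then Θ·A_gnd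 = β·A_orb·Θ. -/
open Matrix

/-- With `A₁₁ = −(k_A/2)L`, `A₂₂ = γA₁₁`, `A₂₁ = (ε₂/2)(I − (γk₁/2)L)`,
`A_orb = [[A₁₁,0],[A₂₁,A₂₂]]`, `A_gnd = [[−D,−P],[I,0]]` where
`D = β(k_A(1+γ)/2)L` and `P = (β²k_A²γ/4)L²`, and `Θ = [[Θ₁₁,Θ₁₂],[0,Θ₂₂]]` built from any
`Θ₁₁` commuting with `L` via `Θ₁₂ = (βk_Aγ/2)LΘ₁₁`, `Θ₂₂ = (βε₂/2)(I − (γk₁/2)L)Θ₁₁`,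
one has `Θ·A_gnd = β·A_orb·Θ`. -/
theorem stmt_15 (n : ℕ) (L Θ₁₁ : Matrix (Fin n) (Fin n) ℝ)
    (β kA γ ε₂ k₁ : ℝ) (hcomm : Θ₁₁ * L = L * Θ₁₁)
    (A₁₁ A₂₂ A₂₁ D P Θ₁₂ Θ₂₂ : Matrix (Fin n) (Fin n) ℝ)
    (hA₁₁ : A₁₁ = (-(kA / 2)) • L)
    (hA₂₂ : A₂₂ = γ • A₁₁)
    (hA₂₁ : A₂₁ = (ε₂ / 2) • (1 - (γ * k₁ / 2) • L))
    (hD : D = (β * (kA * (1 + γ) / 2)) • L)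
    (hP : P = (β ^ 2 * kA ^ 2 * γ / 4) • (L * L))
    (hΘ₁₂ : Θ₁₂ = (β * kA * γ / 2) • (L * Θ₁₁))
    (hΘ₂₂ : Θ₂₂ = (β * ε₂ / 2) • ((1 - (γ * k₁ / 2) • L) * Θ₁₁)) :
    Matrix.fromBlocks Θ₁₁ Θ₁₂ 0 Θ₂₂ * Matrix.fromBlocks (-D) (-P) 1 0
      = β • (Matrix.fromBlocks A₁₁ 0 A₂₁ A₂₂ * Matrix.fromBlocks Θ₁₁ Θ₁₂ 0 Θ₂₂) := by
  have h2 : Θ₁₁ * (L * L) = L * (L * Θ₁₁) := by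
    rw [← mul_assoc, hcomm, mul_assoc, hcomm]
  subst hA₁₁ hA₂₂ hA₂₁ hD hP hΘ₁₂ hΘ₂₂
  rw [Matrix.fromBlocks_multiply, Matrix.fromBlocks_multiply, Matrix.fromBlocks_smul]
  congr 1
  · simp only [mul_neg, mul_smul_comm, smul_mul_assoc, hcomm, mul_one, mul_zero, add_zero]
    module
  · simp only [mul_neg, mul_smul_comm, smul_mul_assoc, h2, mul_zero, zero_mul, add_zero]
    module
  · simp only [mul_smul_comm, smul_mul_assoc, mul_one, mul_zero, zero_mul, add_zero, zero_add]
    module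
  · simp only [mul_smul_comm, smul_mul_assoc, mul_zero, zero_mul, add_zero, sub_mul, mul_sub,
      one_mul]
    module
end

section
/- Let L be an n×n real matrix and β, k_A, γ, ε₂, k₁ real constants with β ≠ 0. Define A₁₁ = −(k_A/2)·L, A₂₂ = γ·A₁₁, and A₂₁ = (ε₂/2)·(Iₙ − (γ k₁/2)·L), and suppose A₂₁ is invertible and commutes with L. Let D and P be n×n matrices, and let Θ₁₁, Θ₁₂, Θ₂₂ be n×n matrices with Θ₁₁ invertible and commuting with L, A₁₁, A₂₂, and A₂₁, satisfying the intertwining conditions (i) −Θ₁₁D + Θ₁₂ = β A₁₁ Θ₁₁, (ii) Θ₂₂ = β A₂₁ Θ₁₁, (iii) −Θ₁₁P = β A₁₁ Θ₁₂, and (iv) A₂₁Θ₁₂ + A₂₂Θ₂₂ = 0, where additionally Θ₁₂ commutes with A₂₁ and A₂₂. Then necessarily D = β·(k_A(1+γ)/2)·L and P = (β² k_A² γ/4)·L², and the quadratic matrix equation β²A₁₁² + βA₁₁D + P = 0 holds. -/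
open Matrix

/-- With `A₁₁ = −(k_A/2)L`, `A₂₂ = γA₁₁`, `A₂₁ = (ε₂/2)(I − (γk₁/2)L)`
(`A₂₁` invertible and commuting with `L`), `β ≠ 0`, and `Θ₁₁` invertible and commuting with
`L`, `A₁₁`, `A₂₂`, `A₂₁`, if the intertwining conditions
(i) `−Θ₁₁D + Θ₁₂ = βA₁₁Θ₁₁`, (ii) `Θ₂₂ = βA₂₁Θ₁₁`, (iii) `−Θ₁₁P = βA₁₁Θ₁₂`,
(iv) `A₂₁Θ₁₂ + A₂₂Θ₂₂ = 0` hold, with `Θ₁₂` commuting with `A₂₁` and `A₂₂`, then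
necessarily `D = β(k_A(1+γ)/2)L`, `P = (β²k_A²γ/4)L²`, and
`β²A₁₁² + βA₁₁D + P = 0`. -/
theorem stmt_16 (n : ℕ) (L : Matrix (Fin n) (Fin n) ℝ)
    (β kA γ ε₂ k₁ : ℝ) (hβ : β ≠ 0)
    (A₁₁ A₂₂ A₂₁ D P Θ₁₁ Θ₁₂ Θ₂₂ : Matrix (Fin n) (Fin n) ℝ)
    (hA₁₁ : A₁₁ = (-(kA / 2)) • L)
    (hA₂₂ : A₂₂ = γ • A₁₁)
    (hA₂₁ : A₂₁ = (ε₂ / 2) • (1 - (γ * k₁ / 2) • L))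
    (hA₂₁inv : IsUnit A₂₁.det)
    (hA₂₁L : A₂₁ * L = L * A₂₁)
    (hΘ₁₁inv : IsUnit Θ₁₁.det)
    (hΘL : Θ₁₁ * L = L * Θ₁₁)
    (hΘA₁₁ : Θ₁₁ * A₁₁ = A₁₁ * Θ₁₁)
    (hΘA₂₂ : Θ₁₁ * A₂₂ = A₂₂ * Θ₁₁)
    (hΘA₂₁ : Θ₁₁ * A₂₁ = A₂₁ * Θ₁₁)
    (hΘ₁₂A₂₁ : Θ₁₂ * A₂₁ = A₂₁ * Θ₁₂)
    (hΘ₁₂A₂₂ : Θ₁₂ * A₂₂ = A₂₂ * Θ₁₂)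
    (hi : -(Θ₁₁ * D) + Θ₁₂ = β • (A₁₁ * Θ₁₁))
    (hii : Θ₂₂ = β • (A₂₁ * Θ₁₁))
    (hiii : -(Θ₁₁ * P) = β • (A₁₁ * Θ₁₂))
    (hiv : A₂₁ * Θ₁₂ + A₂₂ * Θ₂₂ = 0) :
    D = (β * (kA * (1 + γ) / 2)) • L ∧
    P = (β ^ 2 * kA ^ 2 * γ / 4) • (L * L) ∧
    β ^ 2 • (A₁₁ * A₁₁) + β • (A₁₁ * D) + P = 0 := by
  have hu21 : IsUnit A₂₁ := (Matrix.isUnit_iff_isUnit_det _).2 hA₂₁inv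
  have hu11 : IsUnit Θ₁₁ := (Matrix.isUnit_iff_isUnit_det _).2 hΘ₁₁inv
  have h12 : Θ₁₂ = (β * γ * kA / 2) • (Θ₁₁ * L) := by
    apply hu21.mul_left_cancel
    rw [eq_neg_of_add_eq_zero_left hiv, hii, hA₂₂, hA₁₁, hΘL]
    simp only [Matrix.smul_mul, Matrix.mul_smul, smul_smul, ← neg_smul]
    rw [← Matrix.mul_assoc, ← Matrix.mul_assoc, hA₂₁L]
    congr 1
    ring
  have hD : D = (β * (kA * (1 + γ) / 2)) • L := by
    apply hu11.mul_left_cancel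
    have h : Θ₁₁ * D = Θ₁₂ - β • (A₁₁ * Θ₁₁) := by rw [← hi]; abel
    rw [h, h12, ← hΘA₁₁, hA₁₁]
    simp only [Matrix.mul_smul, smul_smul, ← sub_smul]
    congr 1
    ring
  have hP : P = (β ^ 2 * kA ^ 2 * γ / 4) • (L * L) := by
    apply hu11.mul_left_cancel
    rw [← neg_neg (Θ₁₁ * P), hiii, h12, hA₁₁]
    simp only [Matrix.smul_mul, Matrix.mul_smul, smul_smul, ← neg_smul]
    rw [← Matrix.mul_assoc, ← Matrix.mul_assoc, hΘL]
    congr 1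
    ring
  refine ⟨hD, hP, ?_⟩
  rw [hD, hP, hA₁₁]
  simp only [Matrix.smul_mul, Matrix.mul_smul, smul_smul, ← add_smul]
  convert zero_smul ℝ (L * L) using 2
  ring
end
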